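/- arXiv:1003.1293 — 4 statements merged into one kernel-verified Lean document; each statement's English description precedes it below -/
import Mathlib

section
/- Let H be a group with subgroups A and B, let φ : A ≃* B be an isomorphism, and let G = HNN(H, A, B, φ) be the corresponding HNN extension with stable letter t. Assume that AB ∪ BA ≠ H, i.e. there exists a ∈ H that cannot be written as a product x·y with x ∈ A, y ∈ B, nor as y·x with y ∈ B, x ∈ A. Assume moreover that G admits a finite generating set S. Then the conjugacy growth function of G with respect to S is exponential: there exists a constant c > 1 such that g_c(n) ≥ c^n for all sufficiently large n. -/
/-- The ball of radius `n` in a group `G` with respect to a generating set `S`: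
all products of at most `n` elements of `S ∪ S⁻¹`. -/
def wordBall {G : Type*} [Group G] (S : Set G) (n : ℕ) : Set G :=
  {g | ∃ L : List G, L.length ≤ n ∧ (∀ x ∈ L, x ∈ S ∪ S⁻¹) ∧ L.prod = g}

/-- The conjugacy growth function: the number of conjugacy classes of `G`
intersecting the ball of radius `n`. -/
noncomputable def conjGrowth {G : Type*} [Group G] (S : Set G) (n : ℕ) : ℕ :=
  Nat.card {c : ConjClasses G // ∃ g ∈ wordBall S n, ConjClasses.mk g = c}

namespace HNNExtension

variable {H : Type*} [Group H] {A B : Subgroup H} {φ : A ≃* B}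

namespace NormalWord

variable {d : TransversalPair H A B}

/-- The sequence of exponents of the stable letter in a normal word. -/
def exponents (w : NormalWord d) : List ℤˣ := w.toList.map Prod.fst

@[simp]
theorem exponents_empty : (empty : NormalWord d).exponents = [] := rfl

@[simp]
theorem exponents_of_smul (g : H) (w : NormalWord d) :
    ((of g : HNNExtension H A B φ) • w).exponents = w.exponents := by
  rw [of_smul_eq_smul]; rfl

theorem head_of_smul (g : H) (w : NormalWord d) :
    ((of g : HNNExtension H A B φ) • w).head = g * w.head := by
  rw [of_smul_eq_smul]; rfl

theorem exponents_unitsSMul_of_cancels {u : ℤˣ} {w : NormalWord d} (h : Cancels u w) :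
    w.exponents = -u :: (unitsSMul φ u w).exponents := by
  rw [unitsSMul, dif_pos h]
  cases w using consRecOn with
  | ofGroup => simp [Cancels] at h
  | cons g u' w h1 h2 =>
    obtain rfl : u' = -u := by simpa using h.2
    simp [unitsSMulWithCancel, exponents]

theorem exponents_unitsSMul_of_not_cancels {u : ℤˣ} {w : NormalWord d} (h : ¬ Cancels u w) :
    (unitsSMul φ u w).exponents = u :: w.exponents := by
  rw [unitsSMul, dif_neg h]
  simp [exponents]

theorem head_unitsSMul_mem {u : ℤˣ} {w : NormalWord d} (h : ¬ Cancels u w) :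
    (unitsSMul φ u w).head ∈ toSubgroup A B (-u) := by
  rw [unitsSMul, dif_neg h]
  simp

/-- The head of `w` can be moved across the first stable letter of `w`. -/
def HeadMem (w : NormalWord d) : Prop :=
  ∀ u ∈ w.exponents.head?, w.head ∈ toSubgroup A B (-u)

theorem HeadMem.not_cancels {a : H} (ha : ∀ u, a ∉ toSubgroup A B u) {w : NormalWord d}
    (hw : w.HeadMem) (u : ℤˣ) : ¬ Cancels u ((of a : HNNExtension H A B φ) • w) := by
  rintro ⟨h1, h2⟩
  rw [head_of_smul] at h1
  have h3 := hw (-u) (by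
    rw [← exponents_of_smul (φ := φ) a w, exponents, List.head?_map]
    exact h2)
  rw [neg_neg] at h3
  exact ha u ((Subgroup.mul_mem_cancel_right _ h3).1 h1)

theorem headMem_unitsSMul {u : ℤˣ} {w : NormalWord d} (h : ¬ Cancels u w) :
    (unitsSMul φ u w).HeadMem := by
  intro v hv
  rw [exponents_unitsSMul_of_not_cancels h] at hv
  simp only [List.head?_cons, Option.mem_def, Option.some.injEq] at hv
  subst hv
  exact head_unitsSMul_mem h

/-- Left multiplication by a fixed element changes only a bounded prefix of the exponents. -/
theorem exists_exponents_smul (x : HNNExtension H A B φ) :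
    ∃ C : ℕ, ∀ w : NormalWord d, ∃ (p : List ℤˣ) (c : ℕ), p.length ≤ C ∧ c ≤ C ∧
      (x • w).exponents = p ++ w.exponents.drop c := by
  induction x using induction_on with
  | of g => exact ⟨0, fun w => ⟨[], 0, by simp⟩⟩
  | t =>
    refine ⟨1, fun w => ?_⟩
    rw [t_smul_eq_unitsSMul]
    by_cases h : Cancels 1 w
    · exact ⟨[], 1, by simp, le_rfl, by simp [exponents_unitsSMul_of_cancels (φ := φ) h]⟩
    · exact ⟨[1], 0, by simp, by simp, by simp [exponents_unitsSMul_of_not_cancels h]⟩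
  | mul x y hx hy =>
    obtain ⟨C, hC⟩ := hx
    obtain ⟨D, hD⟩ := hy
    refine ⟨C + D, fun w => ?_⟩
    obtain ⟨p, c, hp, hc, h⟩ := hC (y • w)
    obtain ⟨q, e, hq, he, h'⟩ := hD w
    refine ⟨p ++ q.drop c, e + (c - q.length), ?_, by omega, ?_⟩
    · simp only [List.length_append, List.length_drop]; omega
    · rw [mul_smul, h, h', List.drop_append, List.drop_drop, List.append_assoc]
  | inv x hx =>
    obtain ⟨C, hC⟩ := hx
    refine ⟨C, fun w => ?_⟩
    obtain ⟨p, c, hp, hc, h⟩ := hC (x⁻¹ • w)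
    refine ⟨(x⁻¹ • w).exponents.take c, p.length, by simp [hc], hp, ?_⟩
    rw [smul_inv_smul] at h
    rw [h, List.drop_left, List.take_append_drop]

end NormalWord

open NormalWord

/-- The product of the syllables `t ^ f i * a` for `i < N`. -/
def syllableProd (φ : A ≃* B) (a : H) (f : ℕ → ℤˣ) (N : ℕ) : HNNExtension H A B φ :=
  ((List.range N).map fun i => t ^ (f i : ℤ) * of a).prod

theorem syllableProd_succ (a : H) (f : ℕ → ℤˣ) (N : ℕ) :
    syllableProd φ a f (N + 1) = syllableProd φ a f N * (t ^ (f N : ℤ) * of a) := by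
  simp [syllableProd, List.range_succ]

theorem syllableProd_add (a : H) (f : ℕ → ℤˣ) (M N : ℕ) :
    syllableProd φ a f (M + N) =
      syllableProd φ a f M * syllableProd φ a (fun i => f (M + i)) N := by
  simp [syllableProd, List.range_add, Function.comp_def]

theorem syllableProd_mul_of_periodic (a : H) {f : ℕ → ℤˣ} {n : ℕ} (hf : f.Periodic n) (k : ℕ) :
    syllableProd φ a f (n * k) = syllableProd φ a f n ^ k := by
  induction k with
  | zero => simp [syllableProd]
  | succ k ih =>
    have : (fun i => f (n * k + i)) = f := by
      funext i
      have := hf.nat_mul k i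
      rwa [add_comm, mul_comm]
    rw [mul_add_one, syllableProd_add, ih, this, pow_succ]

section

variable {d : TransversalPair H A B} {a : H}

theorem syllableProd_succ_smul (f : ℕ → ℤˣ) (N : ℕ) (w : NormalWord d) :
    syllableProd φ a f (N + 1) • w =
      syllableProd φ a f N • unitsSMul φ (f N) ((of a : HNNExtension H A B φ) • w) := by
  rw [syllableProd_succ, mul_smul, mul_smul, t_pow_smul_eq_unitsSMul]

theorem exponents_syllableProd_smul_of_headMem (ha : ∀ u, a ∉ toSubgroup A B u) (f : ℕ → ℤˣ)
    (N : ℕ) {w : NormalWord d} (hw : w.HeadMem) :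
    (syllableProd φ a f N • w).exponents = (List.range N).map f ++ w.exponents := by
  induction N generalizing w with
  | zero => simp [syllableProd]
  | succ N ih =>
    have hc := hw.not_cancels (φ := φ) ha (f N)
    rw [syllableProd_succ_smul, ih (headMem_unitsSMul hc),
      exponents_unitsSMul_of_not_cancels hc, exponents_of_smul]
    simp [List.range_succ]

theorem exists_exponents_syllableProd_smul (ha : ∀ u, a ∉ toSubgroup A B u) (f : ℕ → ℤˣ)
    (N : ℕ) (w : NormalWord d) :
    ∃ (K : ℕ) (q : List ℤˣ), N ≤ K + w.exponents.length ∧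
      (syllableProd φ a f N • w).exponents = (List.range K).map f ++ q := by
  induction N generalizing w with
  | zero => exact ⟨0, w.exponents, by simp, by simp [syllableProd]⟩
  | succ N ih =>
    rw [syllableProd_succ_smul]
    by_cases hc : Cancels (f N) ((of a : HNNExtension H A B φ) • w)
    · obtain ⟨K, q, hK, h⟩ := ih (unitsSMul φ (f N) ((of a : HNNExtension H A B φ) • w))
      have := congrArg List.length (exponents_unitsSMul_of_cancels (φ := φ) hc)
      rw [exponents_of_smul, List.length_cons] at this
      exact ⟨K, q, by omega, h⟩
    · refine ⟨N + 1, w.exponents, by omega, ?_⟩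
      rw [exponents_syllableProd_smul_of_headMem ha f N (headMem_unitsSMul hc),
        exponents_unitsSMul_of_not_cancels hc, exponents_of_smul]
      simp [List.range_succ]

end

/-- Conjugate syllable products of length `n` have exponent sequences that are cyclic
permutations of one another. -/
theorem exists_eq_add_of_isConj_syllableProd {a : H} (ha : ∀ u, a ∉ toSubgroup A B u)
    {n : ℕ} [NeZero n] {ε δ : ZMod n → ℤˣ}
    (h : IsConj (syllableProd φ a (fun i => ε i) n) (syllableProd φ a (fun i => δ i) n)) :
    ∃ s : ZMod n, δ = fun z => ε (z + s) := by
  obtain ⟨d⟩ := TransversalPair.nonempty H A B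
  obtain ⟨x, hx⟩ := isConj_iff.1 h
  obtain ⟨C, hC⟩ := exists_exponents_smul (d := d) x
  set m := (x • (empty : NormalWord d)).exponents.length with hm
  set k := C + m + 1 with hk
  have hper : ∀ η : ZMod n → ℤˣ, Function.Periodic (fun i : ℕ => η i) n := fun η i => by simp
  have hcomm : x * syllableProd φ a (fun i => ε i) (n * k) =
      syllableProd φ a (fun i => δ i) (n * k) * x := by
    rw [syllableProd_mul_of_periodic a (hper ε), syllableProd_mul_of_periodic a (hper δ)]
    refine SemiconjBy.pow_right ?_ k
    rw [SemiconjBy, ← hx, inv_mul_cancel_right]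
  obtain ⟨p, c, hp, hc, h1⟩ := hC (syllableProd φ a (fun i => ε i) (n * k) • empty)
  obtain ⟨K, q, hK, h2⟩ :=
    exists_exponents_syllableProd_smul (φ := φ) ha (fun i => δ i) (n * k) (x • (empty : NormalWord d))
  rw [exponents_syllableProd_smul_of_headMem ha _ _ (by simp [HeadMem]), ← mul_smul, hcomm,
    mul_smul, h2] at h1
  have hn : 1 ≤ n := NeZero.one_le
  have hnk : n + C + m ≤ n * k := by rw [hk]; nlinarith
  have key : ∀ r < n, δ ((p.length + r : ℕ) : ZMod n) = ε ((c + r : ℕ) : ZMod n) := by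
    intro r hr
    have := congrArg (fun l => l[p.length + r]?) h1
    simp only [exponents_empty, List.append_nil] at this
    rw [List.getElem?_append_left (by simp; omega),
      List.getElem?_append_right (by omega), Nat.add_sub_cancel_left, List.getElem?_drop,
      List.getElem?_map, List.getElem?_map, List.getElem?_range (by omega),
      List.getElem?_range (by omega)] at this
    simpa using this
  refine ⟨(c : ZMod n) - p.length, funext fun z => ?_⟩
  have := key (z - p.length).val (ZMod.val_lt _)
  simp only [Nat.cast_add, ZMod.natCast_val, ZMod.cast_id', id] at this
  convert this using 2 <;> ring

end HNNExtension

section WordBall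

variable {G : Type*} [Group G] {S : Set G}

theorem wordBall_mono {m n : ℕ} (h : m ≤ n) : wordBall S m ⊆ wordBall S n :=
  fun _ ⟨L, h1, h2⟩ => ⟨L, h1.trans h, h2⟩

theorem mul_mem_wordBall {m n : ℕ} {g h : G} (hg : g ∈ wordBall S m) (hh : h ∈ wordBall S n) :
    g * h ∈ wordBall S (m + n) := by
  obtain ⟨L, hL, hL', rfl⟩ := hg
  obtain ⟨M, hM, hM', rfl⟩ := hh
  exact ⟨L ++ M, by simp; omega, by simp only [List.mem_append]; grind, by simp⟩

theorem exists_mem_wordBall (hS : Subgroup.closure S = ⊤) (g : G) : ∃ n, g ∈ wordBall S n := by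
  have hg : g ∈ Submonoid.closure (S ∪ S⁻¹) := by
    rw [← Subgroup.closure_toSubmonoid, hS]; trivial
  obtain ⟨L, hL, rfl⟩ := Submonoid.exists_list_of_mem_closure hg
  exact ⟨L.length, L, le_rfl, hL, rfl⟩

theorem finite_wordBall (hS : S.Finite) (n : ℕ) : (wordBall S n).Finite := by
  have : Finite ↥(S ∪ S⁻¹) := (hS.union hS.inv).to_subtype
  refine ((List.finite_length_le ↥(S ∪ S⁻¹) n).image
    fun L => (L.map Subtype.val).prod).subset ?_
  rintro g ⟨L, hL, hL', rfl⟩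
  lift L to List ↥(S ∪ S⁻¹) using hL'
  exact ⟨L, by simpa using hL, rfl⟩

end WordBall

theorem Nat.sq_le_two_pow_of_four_le {n : ℕ} (hn : 4 ≤ n) : n ^ 2 ≤ 2 ^ n := by
  induction n, hn using Nat.le_induction with
  | base => norm_num
  | succ n hn ih => rw [pow_succ 2]; nlinarith

namespace HNNExtension

variable {H : Type*} [Group H] {A B : Subgroup H} {φ : A ≃* B}

theorem syllableProd_mem_wordBall {S : Set (HNNExtension H A B φ)} {a : H} {C : ℕ}
    (hC : ∀ u : ℤˣ, (t ^ (u : ℤ) * of a : HNNExtension H A B φ) ∈ wordBall S C)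
    (f : ℕ → ℤˣ) (n : ℕ) : syllableProd φ a f n ∈ wordBall S (n * C) := by
  induction n with
  | zero => exact ⟨[], by simp [syllableProd]⟩
  | succ n ih =>
    rw [syllableProd_succ, add_one_mul]
    exact mul_mem_wordBall ih (hC _)

theorem two_pow_le_mul_conjGrowth {S : Set (HNNExtension H A B φ)} (hS : S.Finite) {a : H}
    (ha : ∀ u, a ∉ toSubgroup A B u) {C : ℕ}
    (hC : ∀ u : ℤˣ, (t ^ (u : ℤ) * of a : HNNExtension H A B φ) ∈ wordBall S C)
    {n m : ℕ} (hn : n ≠ 0) (hm : n * C ≤ m) : 2 ^ n ≤ n * conjGrowth S m := by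
  classical
  have : NeZero n := ⟨hn⟩
  let T := {c : ConjClasses (HNNExtension H A B φ) // ∃ g ∈ wordBall S m, ConjClasses.mk g = c}
  have : Finite T := ((finite_wordBall hS m).image ConjClasses.mk).to_subtype
  have := Fintype.ofFinite T
  let F : (ZMod n → ℤˣ) → T := fun ε =>
    ⟨ConjClasses.mk (syllableProd φ a (fun i => ε i) n), _,
      wordBall_mono hm (syllableProd_mem_wordBall hC _ n), rfl⟩
  have h := Finset.card_le_mul_card_image_of_maps_to (f := F) (s := Finset.univ)
    (t := Finset.univ) (fun _ _ => Finset.mem_univ _) n fun b _ => by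
      by_cases hb : ∃ ε, F ε = b
      · obtain ⟨ε, rfl⟩ := hb
        have hsub : (Finset.univ.filter fun δ => F δ = F ε) ⊆
            Finset.univ.image fun (s : ZMod n) (z : ZMod n) => ε (z + s) := by
          intro δ hδ
          have hconj := (ConjClasses.mk_eq_mk_iff_isConj.1
            (congrArg Subtype.val (Finset.mem_filter.1 hδ).2)).symm
          obtain ⟨s, rfl⟩ := exists_eq_add_of_isConj_syllableProd ha hconj
          exact Finset.mem_image_of_mem _ (Finset.mem_univ s)
        refine (Finset.card_le_card hsub).trans (Finset.card_image_le.trans ?_)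
        simp [ZMod.card]
      · rw [Finset.filter_false_of_mem fun ε _ h => hb ⟨ε, h⟩]
        simp
  simpa [conjGrowth, Nat.card_eq_fintype_card, ZMod.card, T] using h

end HNNExtension

/-- If `G = HNN(H, A, B, φ)` is an HNN extension with `AB ∪ BA ≠ H`, and `G` is
finitely generated, then the conjugacy growth function of `G` is exponential. -/
theorem hnn_conj_growth_exponential
    {H : Type*} [Group H] (A B : Subgroup H) (φ : A ≃* B)
    (hA : ∃ a : H, (∀ x ∈ A, ∀ y ∈ B, a ≠ x * y) ∧ (∀ y ∈ B, ∀ x ∈ A, a ≠ y * x))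
    (S : Finset (HNNExtension H A B φ))
    (hS : Subgroup.closure (S : Set (HNNExtension H A B φ)) = ⊤) :
    ∃ c : ℝ, 1 < c ∧ ∃ N : ℕ, ∀ n ≥ N,
      c ^ n ≤ (conjGrowth (S : Set (HNNExtension H A B φ)) n : ℝ) := by
  obtain ⟨a, ha1, ha2⟩ := hA
  have ha : ∀ u, a ∉ HNNExtension.toSubgroup A B u := by
    intro u hu
    rcases Int.units_eq_one_or u with rfl | rfl
    · exact ha1 a hu 1 B.one_mem (by simp)
    · exact ha2 a hu 1 A.one_mem (by simp)
  obtain ⟨C, hC0, hC⟩ : ∃ C : ℕ, 1 ≤ C ∧ ∀ u : ℤˣ,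
      (HNNExtension.t ^ (u : ℤ) * HNNExtension.of a : HNNExtension H A B φ) ∈
        wordBall (S : Set (HNNExtension H A B φ)) C := by
    choose k hk using fun u : ℤˣ => exists_mem_wordBall hS
      (HNNExtension.t ^ (u : ℤ) * HNNExtension.of a : HNNExtension H A B φ)
    exact ⟨1 + ∑ u, k u, by omega, fun u => wordBall_mono
      ((Finset.single_le_sum (f := k) (fun _ _ => Nat.zero_le _) (Finset.mem_univ u)).trans
        (Nat.le_add_left _ _)) (hk u)⟩
  have hCpos : (0 : ℝ) < 4 * C := by positivity
  set c : ℝ := 2 ^ (1 / (4 * C : ℝ)) with hc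
  have hc1 : 1 < c := Real.one_lt_rpow one_lt_two (by positivity)
  have hc4 : c ^ (4 * C) = 2 := by
    rw [hc, ← Real.rpow_natCast, ← Real.rpow_mul zero_le_two]
    push_cast
    rw [one_div_mul_cancel hCpos.ne', Real.rpow_one]
  refine ⟨c, hc1, 4 * C, fun m hm => ?_⟩
  set n := m / C with hn
  have hn4 : 4 ≤ n := (Nat.le_div_iff_mul_le hC0).2 hm
  have hmn : m < (n + 1) * C := by
    rw [mul_comm]; exact Nat.lt_mul_div_succ m hC0
  have hgrowth := HNNExtension.two_pow_le_mul_conjGrowth S.finite_toSet ha hC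
    (n := n) (m := m) (by omega) (Nat.div_mul_le_self m C)
  have hsq : n ^ 2 ≤ 2 ^ n := Nat.sq_le_two_pow_of_four_le hn4
  set g := conjGrowth (S : Set (HNNExtension H A B φ)) m
  have hg : 2 ^ n ≤ g ^ 2 := by
    have h1 : 2 ^ n * 2 ^ n ≤ n ^ 2 * g ^ 2 := by nlinarith
    have h2 : 2 ^ n * 2 ^ n ≤ 2 ^ n * g ^ 2 := h1.trans (Nat.mul_le_mul_right _ hsq)
    exact Nat.le_of_mul_le_mul_left h2 (by positivity)
  refine le_of_pow_le_pow_left₀ two_ne_zero (Nat.cast_nonneg g) ?_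
  calc (c ^ m) ^ 2 = c ^ (m * 2) := (pow_mul _ _ _).symm
    _ ≤ c ^ (4 * C * n) := pow_le_pow_right₀ hc1.le (by nlinarith)
    _ = 2 ^ n := by rw [pow_mul, hc4]
    _ ≤ (g : ℝ) ^ 2 := by exact_mod_cast hg
end

section
/- Let H be a group with subgroups A and B, let φ : A ≃* B be an isomorphism, let G = HNN(H, A, B, φ) with stable letter t, and let a ∈ H be an element not belonging to AB ∪ BA (i.e. a is not a product of an element of A and an element of B, in either order). For positive integers n₁, …, n_k and m₁, …, m_l, the elements t^{n₁}·a·t^{n₂}·a⋯t^{n_k}·a and t^{m₁}·a·t^{m₂}·a⋯t^{m_l}·a of G are conjugate in G if and only if k = l and the tuple (m₁, …, m_l) is a cyclic shift of the tuple (n₁, …, n_k), i.e. there exists j such that n_i = m_{i+j (mod k)} for all i. -/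
namespace HNNExtension

variable {H : Type*} [Group H] {A B : Subgroup H} {φ : A ≃* B}

section Word

variable (φ)

/-- The product `t * g₁ * t * g₂ ⋯ t * gₙ` in the HNN extension. -/
def positiveWord (l : List H) : HNNExtension H A B φ :=
  (l.map fun g => t * of g).prod

/-- The product `t ^ u₁ * g₁ ⋯ t ^ uₙ * gₙ` in the HNN extension. -/
def signedWord (l : List (ℤˣ × H)) : HNNExtension H A B φ :=
  (l.map fun p => t ^ (p.1 : ℤ) * of p.2).prod

@[simp] theorem positiveWord_nil : positiveWord φ [] = 1 := rfl

@[simp] theorem positiveWord_cons (g : H) (l : List H) :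
    positiveWord φ (g :: l) = t * of g * positiveWord φ l := by
  simp [positiveWord]

@[simp] theorem positiveWord_append (l₁ l₂ : List H) :
    positiveWord φ (l₁ ++ l₂) = positiveWord φ l₁ * positiveWord φ l₂ := by
  simp [positiveWord]

@[simp] theorem signedWord_nil : signedWord φ [] = 1 := rfl

@[simp] theorem signedWord_cons (p : ℤˣ × H) (l : List (ℤˣ × H)) :
    signedWord φ (p :: l) = t ^ (p.1 : ℤ) * of p.2 * signedWord φ l := by
  simp [signedWord]

@[simp] theorem signedWord_append (l₁ l₂ : List (ℤˣ × H)) :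
    signedWord φ (l₁ ++ l₂) = signedWord φ l₁ * signedWord φ l₂ := by
  simp [signedWord]

theorem signedWord_map_one (l : List H) :
    signedWord φ (l.map fun g => (1, g)) = positiveWord φ l := by
  simp [signedWord, positiveWord, Function.comp_def]

theorem ReducedWord.prod_eq_of_head_mul_signedWord (w : NormalWord.ReducedWord H A B) :
    w.prod φ = of w.head * signedWord φ w.toList := rfl

theorem t_zpow_mul_of (u : ℤˣ) (x : toSubgroup A B u) :
    (t : HNNExtension H A B φ) ^ (u : ℤ) * of (x : H) =
      of (toSubgroupEquiv φ u x : H) * t ^ (u : ℤ) := by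
  rcases Int.units_eq_one_or u with rfl | rfl
  · simpa using! t_mul_of x
  · simpa using! inv_t_mul_of x

/-- Every word can be rewritten as a reduced word that is no longer. -/
theorem exists_reducedWord_prod_eq (x : H) (l : List (ℤˣ × H)) :
    ∃ w : NormalWord.ReducedWord H A B,
      w.prod φ = of x * signedWord φ l ∧ w.toList.length ≤ l.length := by
  induction l generalizing x with
  | nil => exact ⟨⟨x, [], List.isChain_nil⟩, rfl, le_rfl⟩
  | cons p l ih =>
    obtain ⟨u, g⟩ := p
    obtain ⟨⟨y, l', hl'⟩, hw, hlen⟩ := ih g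
    rw [ReducedWord.prod_eq_of_head_mul_signedWord] at hw
    dsimp only at hw hlen
    by_cases hy : y ∈ toSubgroup A B u ∧ ∃ q ∈ l'.head?, q.1 ≠ u
    · obtain ⟨hyu, q, hq, hqu⟩ := hy
      obtain _ | ⟨q', l''⟩ := l'
      · simp at hq
      · obtain rfl : q' = q := by simpa using hq
        refine ⟨⟨x * toSubgroupEquiv φ u ⟨y, hyu⟩ * q'.2, l'', (List.isChain_cons.1 hl').2⟩, ?_, ?_⟩
        · have ht := t_zpow_mul_of φ u ⟨y, hyu⟩
          dsimp only at ht
          rw [ReducedWord.prod_eq_of_head_mul_signedWord, signedWord_cons, mul_assoc (t ^ _), ← hw,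
            signedWord_cons, ← mul_assoc (t ^ _), ht]
          simp [Int.units_ne_iff_eq_neg.1 hqu, mul_assoc]
        · simp at hlen ⊢
          omega
    · refine ⟨⟨x, (u, y) :: l', List.isChain_cons.2 ⟨?_, hl'⟩⟩, ?_, by simpa using hlen⟩
      · intro q hq hyu
        by_contra h
        exact hy ⟨hyu, q, hq, fun h' => h h'.symm⟩
      · simp [ReducedWord.prod_eq_of_head_mul_signedWord, hw, mul_assoc]

theorem exists_of_mul_signedWord_mul_of (x y : H) (l : List (ℤˣ × H)) :
    ∃ x' l', l'.length = l.length ∧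
      of x * signedWord φ l * of y = of x' * signedWord φ l' := by
  rcases List.eq_nil_or_concat' l with rfl | ⟨l, p, rfl⟩
  · exact ⟨x * y, [], rfl, by simp⟩
  · exact ⟨x, l ++ [(p.1, p.2 * y)], by simp, by simp [mul_assoc]⟩

theorem isChain_map_one (l : List H) :
    (l.map fun g => ((1 : ℤˣ), g)).IsChain
      (fun a b => a.2 ∈ toSubgroup A B a.1 → a.1 = b.1) := by
  induction l with
  | nil => simp
  | cons g l ih =>
    rw [List.map_cons, List.isChain_cons]
    refine ⟨fun p hp _ => ?_, ih⟩
    obtain ⟨_, _, rfl⟩ := List.mem_map.1 (List.mem_of_mem_head? hp)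
    rfl

/-- A positive word, viewed as a reduced word. -/
def positiveReducedWord (A B : Subgroup H) (x : H) (l : List H) :
    NormalWord.ReducedWord H A B :=
  ⟨x, l.map fun g => (1, g), isChain_map_one l⟩

theorem prod_positiveReducedWord (x : H) (l : List H) :
    (positiveReducedWord A B x l).prod φ = of x * positiveWord φ l := by
  rw [ReducedWord.prod_eq_of_head_mul_signedWord, ← signedWord_map_one]
  rfl

end Word

theorem length_eq_and_mem_of_positiveWord_eq {x y : H} {l l' : List H}
    (h : of x * positiveWord φ l = positiveWord φ l' * of y) :
    l.length = l'.length ∧ (l ≠ [] → x ∈ B) := by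
  rcases List.eq_nil_or_concat' l' with rfl | ⟨l', z, rfl⟩
  · have h' : (positiveReducedWord A B x l).prod φ = (positiveReducedWord A B y []).prod φ := by
      simpa [prod_positiveReducedWord] using h
    have := (ReducedWord.map_fst_eq_and_of_prod_eq φ h').1
    have : l = [] := by simpa [positiveReducedWord] using this
    simp [this]
  · have h' : (positiveReducedWord A B x l).prod φ =
        (positiveReducedWord A B 1 (l' ++ [z * y])).prod φ := by
      simpa [prod_positiveReducedWord, mul_assoc] using h
    obtain ⟨h₁, h₂⟩ := ReducedWord.map_fst_eq_and_of_prod_eq φ h'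
    refine ⟨by simpa [positiveReducedWord] using congrArg List.length h₁, fun hl => ?_⟩
    obtain ⟨g, l, rfl⟩ := List.exists_cons_of_ne_nil hl
    simpa [positiveReducedWord] using h₂ 1 (by simp [positiveReducedWord])

/-- If the letters of two positive words lie in a set on which membership in a common double coset
`A g B` forces equality, then the words are determined by the element they represent, up to
multiplication by `H` on the left and by `B` on the right. -/
theorem mem_and_eq_of_positiveWord_eq {S : Set H}
    (hS : ∀ g ∈ S, ∀ h ∈ S, ∀ x ∈ A, h⁻¹ * x * g ∈ B → g = h) {x y : H} (hy : y ∈ B)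
    {l l' : List H} (hl : ∀ g ∈ l, g ∈ S) (hl' : ∀ g ∈ l', g ∈ S)
    (h : of x * positiveWord φ l = positiveWord φ l' * of y) :
    x ∈ B ∧ l = l' := by
  induction l generalizing x l' with
  | nil =>
    have : l' = [] := by simpa [eq_comm] using (length_eq_and_mem_of_positiveWord_eq h).1
    subst this
    have : x = y := of_injective (φ := φ) (by simpa using h)
    exact ⟨this ▸ hy, rfl⟩
  | cons g l ih =>
    obtain ⟨hlen, hx⟩ := length_eq_and_mem_of_positiveWord_eq h
    obtain _ | ⟨g', l'⟩ := l'
    · simp at hlen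
    replace hx := hx (by simp)
    have ht := of_mul_t (φ := φ) ⟨x, hx⟩
    dsimp only at ht
    have h' : of (g'⁻¹ * φ.symm ⟨x, hx⟩ * g) * positiveWord φ l = positiveWord φ l' * of y := by
      rw [positiveWord_cons, ← mul_assoc, ← mul_assoc, ht, positiveWord_cons, mul_assoc t,
        mul_assoc t, mul_assoc t, mul_assoc t, mul_right_inj] at h
      rw [map_mul, map_mul, mul_assoc (of _), mul_assoc (of _), map_inv, inv_mul_eq_iff_eq_mul,
        ← mul_assoc, h, mul_assoc]
    obtain ⟨hB, rfl⟩ := ih (fun k hk => hl k (by simp [hk])) (fun k hk => hl' k (by simp [hk])) h'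
    exact ⟨hx, by rw [hS g (hl g (by simp)) g' (hl' g' (by simp)) _ (φ.symm ⟨x, hx⟩).2 hB]⟩

/-- **Collins' Lemma** for positive words: conjugate positive words have cyclic permutations which
are conjugate by an element of the base group. -/
theorem exists_isRotated_of_positiveWord_conj {x : H} {l : List (ℤˣ × H)} {gs hs : List H}
    (hgs : gs ≠ []) (hhs : hs ≠ [])
    (h : of x * signedWord φ l * positiveWord φ gs =
      positiveWord φ hs * (of x * signedWord φ l)) :
    ∃ gs' hs' : List H, gs' ~r gs ∧ hs' ~r hs ∧
      ∃ y : H, of y * positiveWord φ gs' = positiveWord φ hs' * of y := by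
  induction hn : l.length using Nat.strong_induction_on generalizing x l gs hs with
  | _ n ih =>
  subst hn
  obtain ⟨⟨x, l, hl⟩, hw, hlen⟩ := exists_reducedWord_prod_eq φ x l
  rw [← hw, ReducedWord.prod_eq_of_head_mul_signedWord] at h
  dsimp only at h hlen
  clear hw
  obtain rfl | hnil := eq_or_ne l []
  · exact ⟨gs, hs, .refl _, .refl _, x, by simpa using h⟩
  have step {gs' hs' : List H} (hgs' : gs' ~r gs) (hhs' : hs' ~r hs)
      (y : HNNExtension H A B φ) (hy : y * positiveWord φ gs' = positiveWord φ hs' * y)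
      (x' : H) (l' : List (ℤˣ × H)) (hl' : l'.length < l.length)
      (hy' : y = of x' * signedWord φ l') :
      ∃ gs' hs' : List H, gs' ~r gs ∧ hs' ~r hs ∧
        ∃ y : H, of y * positiveWord φ gs' = positiveWord φ hs' * of y := by
    subst hy'
    obtain ⟨gs'', hs'', h₁, h₂, h₃⟩ := ih _ (hl'.trans_le hlen)
      (fun e => hgs (List.isRotated_nil_iff'.1 (e ▸ hgs')).symm)
      (fun e => hhs (List.isRotated_nil_iff'.1 (e ▸ hhs')).symm) hy rfl
    exact ⟨gs'', hs'', h₁.trans hgs', h₂.trans hhs', h₃⟩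
  by_cases hright : ∀ p ∈ l.getLast?, p.2 ∈ toSubgroup A B p.1 → p.1 = 1
  swap
  · push Not at hright
    obtain ⟨⟨u, b⟩, hp, hb, hu⟩ := hright
    obtain ⟨l, rfl⟩ := List.getLast?_eq_some_iff.1 hp
    obtain rfl : u = -1 := Int.units_ne_iff_eq_neg.1 hu
    obtain ⟨g, gs, rfl⟩ := List.exists_cons_of_ne_nil hgs
    obtain ⟨x', l', hl', hxl'⟩ :=
      exists_of_mul_signedWord_mul_of φ x (φ.symm ⟨b, hb⟩ * g) l
    refine step (gs' := gs ++ [g]) (hs' := hs) ?_ (.refl _)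
      (of x * signedWord φ (l ++ [(-1, b)]) * (t * of g)) ?_ x' l' (by simp [hl']) ?_
    · exact (List.isRotated_append (l := [g]) (l' := gs)).symm
    · rw [positiveWord_cons] at h
      simp only [positiveWord_append, positiveWord_cons, positiveWord_nil, mul_one]
      rw [← mul_assoc (positiveWord φ hs), ← h]
      simp only [mul_assoc]
    · have := equiv_symm_eq_conj (φ := φ) ⟨b, hb⟩
      dsimp only at this
      rw [← hxl', map_mul, this]
      simp [mul_assoc]
  obtain ⟨hs₁, k, rfl⟩ := List.eq_nil_or_concat' hs |>.resolve_left hhs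
  by_cases hleft : ∀ p ∈ l.head?, k * x ∈ A → 1 = p.1
  swap
  · push Not at hleft
    obtain ⟨⟨u, b⟩, hp, hA, hu⟩ := hleft
    obtain ⟨l, rfl⟩ := List.head?_eq_some_iff.1 hp
    obtain rfl : u = -1 := Int.units_ne_iff_eq_neg.1 hu.symm
    refine step (gs' := gs) (hs' := k :: hs₁) (.refl _) ?_
      (t * of k * (of x * signedWord φ ((-1, b) :: l))) ?_ (φ ⟨k * x, hA⟩ * b) l (by simp) ?_
    · exact List.isRotated_append (l := [k]) (l' := hs₁)
    · rw [mul_assoc, h]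
      simp [mul_assoc]
    · have := equiv_eq_conj (φ := φ) ⟨k * x, hA⟩
      dsimp only at this
      rw [map_mul, this]
      simp [mul_assoc]
  have hchain₁ : (l ++ gs.map fun g => ((1 : ℤˣ), g)).IsChain
      (fun a b => a.2 ∈ toSubgroup A B a.1 → a.1 = b.1) := by
    refine List.isChain_append.2 ⟨hl, isChain_map_one gs, fun p hp q hq hp' => ?_⟩
    obtain ⟨_, _, rfl⟩ := List.mem_map.1 (List.mem_of_mem_head? hq)
    exact hright p hp hp'
  have hchain₂ : ((hs₁.map fun g => ((1 : ℤˣ), g)) ++ (1, k * x) :: l).IsChain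
      (fun a b => a.2 ∈ toSubgroup A B a.1 → a.1 = b.1) := by
    refine List.isChain_append.2 ⟨isChain_map_one hs₁, List.isChain_cons.2 ⟨hleft, hl⟩,
      fun p hp q hq _ => ?_⟩
    obtain ⟨_, _, rfl⟩ := List.mem_map.1 (List.mem_of_mem_getLast? hp)
    obtain rfl : (1, k * x) = q := by simpa using hq
    rfl
  have heq : (⟨x, _, hchain₁⟩ : NormalWord.ReducedWord H A B).prod φ =
      (⟨1, _, hchain₂⟩ : NormalWord.ReducedWord H A B).prod φ := by
    rw [ReducedWord.prod_eq_of_head_mul_signedWord, ReducedWord.prod_eq_of_head_mul_signedWord]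
    simpa [signedWord_map_one, mul_assoc] using h
  obtain ⟨⟨u, b⟩, l, rfl⟩ := List.exists_cons_of_ne_nil hnil
  obtain ⟨hfst, hhead⟩ := ReducedWord.map_fst_eq_and_of_prod_eq φ heq
  obtain rfl : u = 1 := by
    obtain _ | ⟨_, _⟩ := hs₁ <;> simp at hfst <;> exact hfst.1
  have hx : x ∈ B := by simpa using hhead 1 (by simp)
  obtain ⟨k', hs₂, hk'⟩ := List.exists_cons_of_ne_nil hhs
  rw [hk'] at h step ⊢
  refine step (gs' := gs) (hs' := hs₂ ++ [k']) (.refl _) ?_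
    ((t * of k')⁻¹ * (of x * signedWord φ ((1, b) :: l))) ?_
    (k'⁻¹ * φ.symm ⟨x, hx⟩ * b) l (by simp) ?_
  · exact (List.isRotated_append (l := [k']) (l' := hs₂)).symm
  · rw [mul_assoc, h]
    simp [mul_assoc]
  · have := equiv_symm_eq_conj (φ := φ) ⟨x, hx⟩
    dsimp only at this
    rw [map_mul, map_mul, this]
    simp [mul_assoc]

/-- Conjugate positive words whose letters lie in a set on which membership in a common double
coset `A g B` forces equality are cyclic permutations of each other. -/
theorem isRotated_of_isConj_positiveWord {S : Set H}
    (hS : ∀ g ∈ S, ∀ h ∈ S, ∀ x ∈ A, h⁻¹ * x * g ∈ B → g = h) {gs hs : List H}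
    (hgs : gs ≠ []) (hhs : hs ≠ []) (hgS : ∀ g ∈ gs, g ∈ S) (hhS : ∀ h ∈ hs, h ∈ S)
    (h : IsConj (positiveWord φ gs) (positiveWord φ hs)) : gs ~r hs := by
  obtain ⟨c, hc⟩ := h
  obtain ⟨d⟩ := NormalWord.TransversalPair.nonempty H A B
  obtain ⟨w, hw⟩ : ∃ w : NormalWord d, w.prod φ = c := (NormalWord.equiv φ d).symm.surjective c
  rw [← hw, SemiconjBy, ReducedWord.prod_eq_of_head_mul_signedWord] at hc
  obtain ⟨gs', hs', hgs', hhs', y, hy⟩ := exists_isRotated_of_positiveWord_conj hgs hhs hc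
  have hne : gs' ≠ [] := fun e => hgs (List.isRotated_nil_iff'.1 (e ▸ hgs')).symm
  have hyB := (length_eq_and_mem_of_positiveWord_eq hy).2 hne
  have := (mem_and_eq_of_positiveWord_eq hS hyB (fun g hg => hgS g (hgs'.mem_iff.1 hg))
    (fun g hg => hhS g (hhs'.mem_iff.1 hg)) hy).2
  exact hgs'.symm.trans (this ▸ hhs')

end HNNExtension

section Blocks

variable {α : Type*} {a b : α}

/-- The concatenation of the blocks `bⁿ⁻¹a`, for `n` in a list. -/
def blockWord (b a : α) (ns : List ℕ) : List α :=
  ns.flatMap fun n => List.replicate (n - 1) b ++ [a]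

@[simp] theorem blockWord_nil : blockWord b a [] = [] := rfl

@[simp] theorem blockWord_cons (n : ℕ) (ns : List ℕ) :
    blockWord b a (n :: ns) = List.replicate (n - 1) b ++ a :: blockWord b a ns := by
  simp [blockWord]

@[simp] theorem blockWord_append (ns ms : List ℕ) :
    blockWord b a (ns ++ ms) = blockWord b a ns ++ blockWord b a ms := by
  simp [blockWord]

theorem blockWord_eq_nil_iff {ns : List ℕ} : blockWord b a ns = [] ↔ ns = [] := by
  cases ns <;> simp

theorem mem_blockWord {ns : List ℕ} {x : α} (hx : x ∈ blockWord b a ns) : x = b ∨ x = a := by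
  induction ns with
  | nil => simp at hx
  | cons n ns ih => simp at hx; grind

theorem eq_of_mem_getLast?_blockWord {ns : List ℕ} {x : α}
    (hx : x ∈ (blockWord b a ns).getLast?) : x = a := by
  rcases List.eq_nil_or_concat' ns with rfl | ⟨ns, n, rfl⟩
  · simp at hx
  · simpa [eq_comm] using hx

theorem replicate_append_cons_inj (hab : a ≠ b) {m n : ℕ} {l l' : List α}
    (h : List.replicate m b ++ a :: l = List.replicate n b ++ a :: l') : m = n ∧ l = l' := by
  induction m generalizing n with
  | zero =>
    cases n <;> simp_all [List.replicate_succ]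
  | succ m ih =>
    cases n with
    | zero => simp_all [List.replicate_succ, eq_comm]
    | succ n =>
      simp only [List.replicate_succ, List.cons_append, List.cons.injEq, true_and] at h
      simpa using ih h

theorem blockWord_injective (hab : a ≠ b) {ns ms : List ℕ} (hns : ∀ i ∈ ns, 0 < i)
    (hms : ∀ i ∈ ms, 0 < i) (h : blockWord b a ns = blockWord b a ms) : ns = ms := by
  induction ns generalizing ms with
  | nil => exact (blockWord_eq_nil_iff.1 h.symm).symm
  | cons n ns ih =>
    obtain _ | ⟨m, ms⟩ := ms
    · simp at h
    · obtain ⟨h₁, h₂⟩ := replicate_append_cons_inj hab (by simpa using h)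
      have := hns n (by simp)
      have := hms m (by simp)
      rw [ih (fun i hi => hns i (by simp [hi])) (fun i hi => hms i (by simp [hi])) h₂,
        show n = m by omega]

/-- A prefix of a block word that ends in the separating letter is itself a block word. -/
theorem exists_append_of_blockWord_eq_append (hab : a ≠ b) {ns : List ℕ} {p q : List α}
    (hp : ∀ x ∈ p.getLast?, x = a) (h : blockWord b a ns = p ++ q) :
    ∃ ns₁ ns₂, ns = ns₁ ++ ns₂ ∧ blockWord b a ns₁ = p ∧ blockWord b a ns₂ = q := by
  induction ns generalizing p with
  | nil =>
    obtain ⟨rfl, rfl⟩ : p = [] ∧ q = [] := by simpa [eq_comm] using h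
    exact ⟨[], [], by simp⟩
  | cons n ns ih =>
    obtain rfl | ⟨p, x, rfl⟩ := List.eq_nil_or_concat' p
    · exact ⟨[], n :: ns, by simp, by simp, by simpa using h⟩
    obtain rfl : x = a := hp x (by simp)
    rw [blockWord_cons, ← List.singleton_append, ← List.append_assoc,
      List.append_eq_append_iff] at h
    obtain ⟨c, hc, hq⟩ | ⟨c, hc, hq⟩ := h
    · obtain ⟨ns₁, ns₂, rfl, h₁, h₂⟩ := ih (p := c) (fun y hy => by
        have := hp y
        rw [hc, List.getLast?_append, hy] at this
        exact this (by simp)) hq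
      exact ⟨n :: ns₁, ns₂, rfl, by simp [hc, h₁], h₂⟩
    · obtain rfl | ⟨c, y, rfl⟩ := List.eq_nil_or_concat' c
      · exact ⟨[n], ns, rfl, by simpa using hc, by simpa using hq.symm⟩
      · rw [← List.append_assoc] at hc
        have : x ∈ List.replicate (n - 1) b := by
          rw [(List.append_inj' hc rfl).1]
          simp
        exact absurd (List.eq_of_mem_replicate this) hab

theorem isRotated_of_isRotated_blockWord (hab : a ≠ b) {ns ms : List ℕ} (hns : ∀ i ∈ ns, 0 < i)
    (hms : ∀ i ∈ ms, 0 < i) (h : blockWord b a ns ~r blockWord b a ms) : ns ~r ms := by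
  obtain ⟨j, hj, h⟩ := List.isRotated_iff_mod.1 h
  rw [List.rotate_eq_drop_append_take hj] at h
  obtain ⟨ns₁, ns₂, rfl, h₁, h₂⟩ := exists_append_of_blockWord_eq_append hab
    (p := (blockWord b a ns).take j) (q := (blockWord b a ns).drop j)
    (fun x hx => eq_of_mem_getLast?_blockWord (b := b) (ns := ms) (by
      rw [← h, List.getLast?_append, hx]; simp)) (List.take_append_drop _ _).symm
  rw [← h₁, ← h₂, ← blockWord_append] at h
  rw [← blockWord_injective hab (fun i hi => hns i (by simp at hi ⊢; tauto)) hms h]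
  exact List.isRotated_append

end Blocks

theorem List.IsRotated.isConj_prod {G : Type*} [Group G] {l l' : List G} (h : l ~r l') :
    IsConj l.prod l'.prod := by
  obtain ⟨j, hj, rfl⟩ := List.isRotated_iff_mod.1 h
  rw [List.rotate_eq_drop_append_take hj, List.prod_append]
  nth_rw 1 [← List.take_append_drop j l]
  rw [List.prod_append]
  exact isConj_iff.2 ⟨(l.take j).prod⁻¹, by group⟩

theorem HNNExtension.positiveWord_blockWord {H : Type*} [Group H] {A B : Subgroup H}
    (φ : A ≃* B) (a : H) {ns : List ℕ} (hns : ∀ i ∈ ns, 0 < i) :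
    positiveWord φ (blockWord 1 a ns) =
      (ns.map fun i => (t : HNNExtension H A B φ) ^ i * of a).prod := by
  have hrep (n : ℕ) : positiveWord φ (List.replicate n 1) = t ^ n := by
    simp [positiveWord]
  induction ns with
  | nil => simp
  | cons n ns ih =>
    have hn : t ^ n = (t : HNNExtension H A B φ) ^ (n - 1) * t := by
      rw [← pow_succ, Nat.sub_add_cancel (hns n (by simp))]
    simp [ih fun i hi => hns i (by simp [hi]), hrep, hn, mul_assoc]

open HNNExtension in
/-- In an HNN extension `G = HNN(H, A, B, φ)` with stable letter `t`, for
`a ∈ H \ (AB ∪ BA)` and positive integers `n₁, …, n_k` and `m₁, …, m_l`, the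
elements `t^{n₁}·a·t^{n₂}·a⋯t^{n_k}·a` and `t^{m₁}·a·t^{m₂}·a⋯t^{m_l}·a` are
conjugate in `G` if and only if `k = l` and `(m₁, …, m_l)` is a cyclic shift of
`(n₁, …, n_k)`. -/
theorem hnn_conjugacy_iff_cyclic_shift
    {H : Type*} [Group H] (A B : Subgroup H) (φ : A ≃* B) (a : H)
    (ha : (∀ x ∈ A, ∀ y ∈ B, a ≠ x * y) ∧ (∀ y ∈ B, ∀ x ∈ A, a ≠ y * x))
    (ns ms : List ℕ) (hns : ns ≠ []) (hms : ms ≠ [])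
    (hnpos : ∀ i ∈ ns, 0 < i) (hmpos : ∀ i ∈ ms, 0 < i) :
    IsConj ((ns.map (fun i => (t : HNNExtension H A B φ) ^ i * of a)).prod)
        ((ms.map (fun i => (t : HNNExtension H A B φ) ^ i * of a)).prod)
      ↔ ns.length = ms.length ∧ ∃ j : ℕ, ns.rotate j = ms := by
  constructor
  · intro h
    have ha1 : a ≠ 1 := by simpa using ha.1 1 A.one_mem 1 B.one_mem
    rw [← positiveWord_blockWord φ a hnpos, ← positiveWord_blockWord φ a hmpos] at h
    have hS : ∀ g ∈ ({1, a} : Set H), ∀ h ∈ ({1, a} : Set H), ∀ x ∈ A,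
        h⁻¹ * x * g ∈ B → g = h := by
      rintro g (rfl | rfl) h (rfl | rfl) x hx hB
      · rfl
      · exact absurd (by group) (ha.1 x hx _ (B.inv_mem hB))
      · exact absurd (by group) (ha.1 x⁻¹ (A.inv_mem hx) _ hB)
      · rfl
    have hrot := isRotated_of_isRotated_blockWord ha1 hnpos hmpos <|
      isRotated_of_isConj_positiveWord hS (mt blockWord_eq_nil_iff.1 hns)
        (mt blockWord_eq_nil_iff.1 hms) (fun _ => mem_blockWord) (fun _ => mem_blockWord) h
    exact ⟨hrot.perm.length_eq, hrot⟩
  · rintro ⟨-, hrot⟩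
    exact (List.IsRotated.map hrot _).isConj_prod
end

section
/- Let n ≥ 2 and let BS(1,n) = ⟨a, b ∣ b⁻¹ab = aⁿ⟩ be the Baumslag–Solitar group with generating set S = {a, b}. Then the conjugacy growth function of BS(1,n) with respect to S is exponential: there exists c > 1 such that g_c(m) ≥ c^m for all sufficiently large m. -/
/-- The defining relation `b⁻¹ aᵐ b (aⁿ)⁻¹` of the Baumslag–Solitar group. -/
def bsRels (m n : ℕ) : Set (FreeGroup (Fin 2)) :=
  {(FreeGroup.of 1)⁻¹ * (FreeGroup.of 0) ^ m * FreeGroup.of 1 * ((FreeGroup.of 0) ^ n)⁻¹}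

/-- The Baumslag–Solitar group `BS(m,n) = ⟨a, b ∣ b⁻¹ aᵐ b = aⁿ⟩`. -/
abbrev BS (m n : ℕ) : Type := PresentedGroup (bsRels m n)

/-- The generator `a` of `BS(m,n)`. -/
def bsA (m n : ℕ) : BS m n := PresentedGroup.of 0

/-- The generator `b` of `BS(m,n)`. -/
def bsB (m n : ℕ) : BS m n := PresentedGroup.of 1

theorem wordBall_mono_s3 {G : Type*} [Group G] (S : Set G) {p q : ℕ} (h : p ≤ q) :
    wordBall S p ⊆ wordBall S q := by
  rintro g ⟨L, hL, hS, rfl⟩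
  exact ⟨L, hL.trans h, hS, rfl⟩

theorem one_mem_wordBall {G : Type*} [Group G] (S : Set G) (p : ℕ) : 1 ∈ wordBall S p :=
  ⟨[], by simp, by simp, rfl⟩

theorem mem_wordBall_one {G : Type*} [Group G] {S : Set G} {x : G} (hx : x ∈ S ∪ S⁻¹) :
    x ∈ wordBall S 1 :=
  ⟨[x], by simp, by simpa using hx, by simp⟩

theorem mul_mem_wordBall_s3 {G : Type*} [Group G] {S : Set G} {p q : ℕ} {x y : G}
    (hx : x ∈ wordBall S p) (hy : y ∈ wordBall S q) : x * y ∈ wordBall S (p + q) := by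
  obtain ⟨L, hL, hLS, rfl⟩ := hx
  obtain ⟨M, hM, hMS, rfl⟩ := hy
  refine ⟨L ++ M, by simp; omega, fun x hx => ?_, by simp⟩
  exact (List.mem_append.1 hx).elim (hLS x) (hMS x)

theorem pow_mem_wordBall {G : Type*} [Group G] {S : Set G} {x : G} (hx : x ∈ S) (p : ℕ) :
    x ^ p ∈ wordBall S p :=
  ⟨List.replicate p x, by simp, fun _ hy => Or.inl (List.eq_of_mem_replicate hy ▸ hx), by simp⟩

theorem finite_wordBall_s3 {G : Type*} [Group G] {S : Set G} (hS : S.Finite) (p : ℕ) :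
    (wordBall S p).Finite := by
  have : Finite ↥(S ∪ S⁻¹) := (hS.union hS.inv).to_subtype
  refine ((List.finite_length_le ↥(S ∪ S⁻¹) p).image
    fun L => (L.map Subtype.val).prod).subset ?_
  rintro g ⟨L, hL, hLS, rfl⟩
  lift L to List ↥(S ∪ S⁻¹) using hLS
  exact ⟨L, by simpa using hL, rfl⟩

/-- A family of pairwise non-conjugate elements of a ball bounds the conjugacy growth below. -/
theorem le_conjGrowth {G : Type*} [Group G] {S : Set G} (hS : S.Finite) {p k : ℕ} (f : Fin k → G)
    (hf : ∀ i, f i ∈ wordBall S p) (hinj : ∀ i j, IsConj (f i) (f j) → i = j) :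
    k ≤ conjGrowth S p := by
  have : Finite {c : ConjClasses G // ∃ g ∈ wordBall S p, ConjClasses.mk g = c} :=
    ((finite_wordBall_s3 hS p).image ConjClasses.mk).to_subtype
  have h := Nat.card_le_card_of_injective
    (fun i : Fin k => (⟨ConjClasses.mk (f i), f i, hf i, rfl⟩ :
      {c : ConjClasses G // ∃ g ∈ wordBall S p, ConjClasses.mk g = c}))
    (fun i j hij => hinj i j (ConjClasses.mk_eq_mk_iff_isConj.1 (congrArg Subtype.val hij)))
  simpa [conjGrowth] using h

theorem bsB_inv_mul_bsA_mul_bsB (n : ℕ) :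
    (bsB 1 n)⁻¹ * bsA 1 n * bsB 1 n = bsA 1 n ^ n := by
  have h : (PresentedGroup.mk (bsRels 1 n)) ((FreeGroup.of 1)⁻¹ * (FreeGroup.of 0) ^ 1 *
      FreeGroup.of 1 * ((FreeGroup.of 0) ^ n)⁻¹) = 1 :=
    PresentedGroup.one_of_mem (Set.mem_singleton _)
  simp only [map_mul, map_inv, map_pow, pow_one] at h
  exact mul_inv_eq_one.1 h

theorem bsB_inv_mul_bsA_pow_mul_bsB (n k : ℕ) :
    (bsB 1 n)⁻¹ * bsA 1 n ^ k * bsB 1 n = bsA 1 n ^ (n * k) := by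
  rw [pow_mul, ← bsB_inv_mul_bsA_mul_bsB]
  simpa using (conj_pow (i := k) (a := (bsB 1 n)⁻¹) (b := bsA 1 n)).symm

/-- Powers of `a` are exponentially distorted, by the Horner scheme in base `n`. -/
theorem bsA_pow_mem_wordBall {n : ℕ} (hn : 0 < n) (r : ℕ) : ∀ k < n ^ r,
    bsA 1 n ^ k ∈ wordBall ({bsA 1 n, bsB 1 n} : Set (BS 1 n)) ((n + 1) * r) := by
  induction r with
  | zero =>
    intro k hk
    obtain rfl : k = 0 := by simpa using hk
    simpa using one_mem_wordBall _ _
  | succ r ih =>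
    intro k hk
    have hq : k / n < n ^ r := Nat.div_lt_of_lt_mul (by rwa [pow_succ'] at hk)
    have hk' : bsA 1 n ^ k =
        (bsB 1 n)⁻¹ * bsA 1 n ^ (k / n) * bsB 1 n * bsA 1 n ^ (k % n) := by
      rw [bsB_inv_mul_bsA_pow_mul_bsB, ← pow_add, Nat.div_add_mod]
    rw [hk']
    refine wordBall_mono_s3 _ ?_ (mul_mem_wordBall_s3 (mul_mem_wordBall_s3 (mul_mem_wordBall_s3
      (mem_wordBall_one ?_) (ih _ hq)) (mem_wordBall_one ?_)) (pow_mem_wordBall ?_ _))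
    · have := Nat.mod_lt k hn
      rw [mul_add]
      omega
    all_goals simp

/-- The affine action of `BS(1,n)` on `ℚ`, with `a` acting by `x ↦ x + 1` and `b` by
`x ↦ n⁻¹ * x`. -/
noncomputable def bsAffine (n : ℕ) (hn : (n : ℚ) ≠ 0) : BS 1 n →* Equiv.Perm ℚ :=
  PresentedGroup.toGroup
    (f := ![Equiv.addRight 1, (Equiv.mulLeft₀ (n : ℚ) hn)⁻¹]) (by
      rintro _ rfl
      ext x
      simp [Equiv.Perm.mul_apply, Equiv.Perm.inv_def, mul_add, hn])

theorem bsAffine_bsA_pow (n : ℕ) (hn : (n : ℚ) ≠ 0) (k : ℕ) (x : ℚ) :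
    bsAffine n hn (bsA 1 n ^ k) x = x + k := by
  simp [bsAffine, bsA]

theorem exists_slope_bsAffine (n : ℕ) (hn : (n : ℚ) ≠ 0) (g : BS 1 n) :
    ∃ j : ℤ, ∀ x y : ℚ, bsAffine n hn g x - bsAffine n hn g y = (n : ℚ) ^ j * (x - y) := by
  have inv_slope : ∀ g : BS 1 n,
      (∃ j : ℤ, ∀ x y : ℚ, bsAffine n hn g x - bsAffine n hn g y = (n : ℚ) ^ j * (x - y)) →
      ∃ j : ℤ, ∀ x y : ℚ,
        bsAffine n hn g⁻¹ x - bsAffine n hn g⁻¹ y = (n : ℚ) ^ j * (x - y) := by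
    rintro g ⟨j, hj⟩
    refine ⟨-j, fun x y => ?_⟩
    have h := hj ((bsAffine n hn g)⁻¹ x) ((bsAffine n hn g)⁻¹ y)
    simp only [Equiv.Perm.inv_def, Equiv.apply_symm_apply] at h
    rw [h, map_inv, Equiv.Perm.inv_def, ← mul_assoc, ← zpow_add₀ hn]
    simp
  induction g using PresentedGroup.induction_on with
  | _ z =>
    induction z using FreeGroup.induction_on with
    | C1 => exact ⟨0, by simp⟩
    | of i =>
      fin_cases i
      · refine ⟨0, fun x y => ?_⟩
        change bsAffine n hn (PresentedGroup.of 0) x - bsAffine n hn (PresentedGroup.of 0) y = _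
        simp [bsAffine]
      · refine ⟨-1, fun x y => ?_⟩
        change bsAffine n hn (PresentedGroup.of 1) x - bsAffine n hn (PresentedGroup.of 1) y = _
        simp [bsAffine, mul_sub]
    | inv_of i h => simpa using inv_slope _ h
    | mul z w hz hw =>
      obtain ⟨j, hj⟩ := hz
      obtain ⟨k, hk⟩ := hw
      exact ⟨j + k, fun x y => by
        simp only [map_mul, Equiv.Perm.mul_apply, hj, hk, zpow_add₀ hn, mul_assoc]⟩

theorem exists_zpow_mul_eq_of_isConj {n : ℕ} (hn : (n : ℚ) ≠ 0) {k l : ℕ}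
    (h : IsConj (bsA 1 n ^ k) (bsA 1 n ^ l)) : ∃ j : ℤ, (n : ℚ) ^ j * k = l := by
  obtain ⟨g, hg⟩ := isConj_iff.1 h
  obtain ⟨j, hj⟩ := exists_slope_bsAffine n hn g
  refine ⟨j, ?_⟩
  have h1 := congrArg (fun u => bsAffine n hn u 0) (mul_inv_eq_iff_eq_mul.1 hg)
  simp only [map_mul, Equiv.Perm.mul_apply] at h1
  rw [bsAffine_bsA_pow, bsAffine_bsA_pow] at h1
  have h2 := hj (0 + k) 0
  rw [h1] at h2
  simpa using h2.symm

theorem eq_of_pow_mul_eq {n : ℕ} (hn : 2 ≤ n) {i j t : ℕ}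
    (h : n ^ t * (n * i + 1) = n * j + 1) : i = j := by
  cases t with
  | zero => exact Nat.eq_of_mul_eq_mul_left (by omega : 0 < n) (by simpa using h)
  | succ t =>
    have h1 : n ∣ n * j + 1 := h ▸ Dvd.dvd.mul_right (dvd_pow_self n t.succ_ne_zero) _
    have h2 : n ∣ 1 := (Nat.dvd_add_right (dvd_mul_right n j)).1 h1
    have := Nat.le_of_dvd one_pos h2
    omega

theorem eq_of_isConj_bsA_pow {n : ℕ} (hn : 2 ≤ n) {i j : ℕ}
    (h : IsConj (bsA 1 n ^ (n * i + 1)) (bsA 1 n ^ (n * j + 1))) : i = j := by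
  have hn0 : (n : ℚ) ≠ 0 := by positivity
  obtain ⟨t, ht⟩ := exists_zpow_mul_eq_of_isConj hn0 h
  obtain ⟨t, rfl | rfl⟩ := t.eq_nat_or_neg
  · rw [zpow_natCast] at ht
    exact eq_of_pow_mul_eq hn (by exact_mod_cast ht)
  · rw [zpow_neg, zpow_natCast, inv_mul_eq_iff_eq_mul₀ (pow_ne_zero _ hn0)] at ht
    exact (eq_of_pow_mul_eq hn (by exact_mod_cast ht.symm)).symm

theorem pow_le_conjGrowth_bs {n : ℕ} (hn : 2 ≤ n) {r m : ℕ} (hm : (n + 1) * (r + 1) ≤ m) :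
    n ^ r ≤ conjGrowth ({bsA 1 n, bsB 1 n} : Set (BS 1 n)) m := by
  refine le_conjGrowth (Set.toFinite _) (fun i : Fin (n ^ r) => bsA 1 n ^ (n * (i : ℕ) + 1))
    (fun i => wordBall_mono_s3 _ hm (bsA_pow_mem_wordBall (by omega) _ _ ?_))
    (fun i j h => Fin.ext (eq_of_isConj_bsA_pow hn h))
  have := Nat.mul_le_mul_left n (Nat.succ_le_of_lt i.isLt)
  rw [pow_succ']
  rw [Nat.mul_succ] at this
  omega

/-- For `n ≥ 2`, the conjugacy growth function of `BS(1,n)` with respect to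
`S = {a, b}` is exponential. -/
theorem bs_one_n_conj_growth_exponential (n : ℕ) (hn : 2 ≤ n) :
    ∃ c : ℝ, 1 < c ∧ ∃ N : ℕ, ∀ m ≥ N,
      c ^ m ≤ (conjGrowth ({bsA 1 n, bsB 1 n} : Set (BS 1 n)) m : ℝ) := by
  have hn1 : (1 : ℝ) < n := by exact_mod_cast hn
  set c : ℝ := (n : ℝ) ^ (((3 * (n + 1) : ℕ) : ℝ)⁻¹)
  have hc1 : 1 < c := Real.one_lt_rpow hn1 (by positivity)
  have hcn : c ^ (3 * (n + 1)) = n := Real.rpow_inv_natCast_pow (by positivity) (by positivity)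
  refine ⟨c, hc1, 2 * (n + 1), fun m hm => ?_⟩
  obtain ⟨r, hr⟩ : ∃ r, m / (n + 1) = r + 2 :=
    Nat.exists_eq_add_of_le' ((Nat.le_div_iff_mul_le n.succ_pos).2 hm)
  have hlow : (n + 1) * (r + 2) ≤ m := hr ▸ Nat.mul_div_le m (n + 1)
  have hhigh : m < (n + 1) * (r + 2 + 1) := hr ▸ Nat.lt_mul_div_succ m n.succ_pos
  calc c ^ m ≤ c ^ (3 * (n + 1) * (r + 1)) := pow_le_pow_right₀ hc1.le (by nlinarith)
    _ = ((n ^ (r + 1) : ℕ) : ℝ) := by rw [pow_mul, hcn, Nat.cast_pow]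
    _ ≤ _ := by exact_mod_cast pow_le_conjGrowth_bs hn hlow
end

section
/- Let H = ⟨x, y, z ∣ [x,y] = z, zx = xz, zy = yz⟩ be the discrete Heisenberg group, realized as the group of 3×3 upper unitriangular integer matrices with x = I + E₁₂, y = I + E₂₃, z = I + E₁₃, and let S = {x, y}. Then the conjugacy growth function of H with respect to S satisfies g_c(n) = Θ(n² log n): there exists a constant C ≥ 1 such that (1/C)·n²·log n ≤ g_c(n) ≤ C·n²·log n for all sufficiently large n. -/
/-- A 3×3 integer matrix is upper unitriangular. -/
def IsUnitri (M : Matrix (Fin 3) (Fin 3) ℤ) : Prop :=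
  M 0 0 = 1 ∧ M 1 1 = 1 ∧ M 2 2 = 1 ∧ M 1 0 = 0 ∧ M 2 0 = 0 ∧ M 2 1 = 0

/-- The discrete Heisenberg group: 3×3 upper unitriangular integer matrices. -/
def Heis : Type := {M : Matrix (Fin 3) (Fin 3) ℤ // IsUnitri M}

namespace Heis

instance : Group Heis where
  mul A B := ⟨A.1 * B.1, by
    obtain ⟨a1, a2, a3, a4, a5, a6⟩ := A.2
    obtain ⟨b1, b2, b3, b4, b5, b6⟩ := B.2
    refine ⟨?_, ?_, ?_, ?_, ?_, ?_⟩ <;>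
      simp [Matrix.mul_apply, Fin.sum_univ_three, a1, a2, a3, a4, a5, a6,
        b1, b2, b3, b4, b5, b6]⟩
  one := ⟨1, by refine ⟨?_, ?_, ?_, ?_, ?_, ?_⟩ <;> simp [Matrix.one_apply]⟩
  inv A := ⟨!![1, -(A.1 0 1), A.1 0 1 * A.1 1 2 - A.1 0 2;
               0, 1, -(A.1 1 2);
               0, 0, 1], by
    refine ⟨?_, ?_, ?_, ?_, ?_, ?_⟩ <;> simp [Matrix.vecHead, Matrix.vecTail]⟩
  mul_assoc A B C := Subtype.ext (mul_assoc A.1 B.1 C.1)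
  one_mul A := Subtype.ext (one_mul A.1)
  mul_one A := Subtype.ext (mul_one A.1)
  inv_mul_cancel A := by
    obtain ⟨a1, a2, a3, a4, a5, a6⟩ := A.2
    apply Subtype.ext
    show _ * A.1 = (1 : Matrix (Fin 3) (Fin 3) ℤ)
    ext i j
    fin_cases i <;> fin_cases j <;>
      simp [Matrix.mul_apply, Fin.sum_univ_three, Matrix.one_apply,
        a1, a2, a3, a4, a5, a6] <;> ring

/-- The generator `x = I + E₁₂`. -/
def x : Heis := ⟨!![1, 1, 0; 0, 1, 0; 0, 0, 1], by
  refine ⟨?_, ?_, ?_, ?_, ?_, ?_⟩ <;> simp [Matrix.vecHead, Matrix.vecTail]⟩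

/-- The generator `y = I + E₂₃`. -/
def y : Heis := ⟨!![1, 0, 0; 0, 1, 1; 0, 0, 1], by
  refine ⟨?_, ?_, ?_, ?_, ?_, ?_⟩ <;> simp [Matrix.vecHead, Matrix.vecTail]⟩

/-- The central element `z = I + E₁₃`. -/
def z : Heis := ⟨!![1, 0, 1; 0, 1, 0; 0, 0, 1], by
  refine ⟨?_, ?_, ?_, ?_, ?_, ?_⟩ <;> simp [Matrix.vecHead, Matrix.vecTail]⟩

end Heis

namespace Heis

/-- The element `x^a y^b z^(c - a b)`, with entries `a`, `b`, `c` above the diagonal. -/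
def ofEntries (a b c : ℤ) : Heis := ⟨!![1, a, c; 0, 1, b; 0, 0, 1], by
  refine ⟨?_, ?_, ?_, ?_, ?_, ?_⟩ <;> simp⟩

theorem exists_eq_ofEntries (g : Heis) : ∃ a b c, g = ofEntries a b c := by
  obtain ⟨h1, h2, h3, h4, h5, h6⟩ := g.2
  refine ⟨g.1 0 1, g.1 1 2, g.1 0 2, Subtype.ext ?_⟩
  ext i j
  fin_cases i <;> fin_cases j <;> simp [ofEntries, h1, h2, h3, h4, h5, h6]

theorem ofEntries_mul (a b c a' b' c' : ℤ) :
    ofEntries a b c * ofEntries a' b' c' = ofEntries (a + a') (b + b') (c + c' + a * b') := by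
  apply Subtype.ext
  change (ofEntries a b c).1 * (ofEntries a' b' c').1 = _
  ext i j
  fin_cases i <;> fin_cases j <;>
    simp [ofEntries, Matrix.mul_apply, Fin.sum_univ_three] <;> ring

theorem ofEntries_inj {a b c a' b' c' : ℤ} :
    ofEntries a b c = ofEntries a' b' c' ↔ a = a' ∧ b = b' ∧ c = c' := by
  constructor
  · intro h
    have h' := congrArg Subtype.val h
    have h1 := congrFun (congrFun h' 0) 1
    have h2 := congrFun (congrFun h' 1) 2
    have h3 := congrFun (congrFun h' 0) 2
    simp [ofEntries] at h1 h2 h3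
    exact ⟨h1, h2, h3⟩
  · rintro ⟨rfl, rfl, rfl⟩
    rfl

theorem one_eq_ofEntries : (1 : Heis) = ofEntries 0 0 0 := by
  have h := ofEntries_mul 0 0 0 0 0 0
  simp only [add_zero, mul_zero] at h
  exact (mul_eq_left.mp h).symm

theorem x_eq_ofEntries : x = ofEntries 1 0 0 := rfl

theorem y_eq_ofEntries : y = ofEntries 0 1 0 := rfl

theorem inv_x_eq_ofEntries : x⁻¹ = ofEntries (-1) 0 0 := by
  rw [inv_eq_iff_mul_eq_one, x_eq_ofEntries, ofEntries_mul, one_eq_ofEntries]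
  norm_num

theorem inv_y_eq_ofEntries : y⁻¹ = ofEntries 0 (-1) 0 := by
  rw [inv_eq_iff_mul_eq_one, y_eq_ofEntries, ofEntries_mul, one_eq_ofEntries]
  norm_num

theorem x_pow (k : ℕ) : x ^ k = ofEntries k 0 0 := by
  induction k with
  | zero => simp [one_eq_ofEntries]
  | succ k ih => rw [pow_succ, ih, x_eq_ofEntries, ofEntries_mul]; simp

theorem y_pow (k : ℕ) : y ^ k = ofEntries 0 k 0 := by
  induction k with
  | zero => simp [one_eq_ofEntries]
  | succ k ih => rw [pow_succ, ih, y_eq_ofEntries, ofEntries_mul]; simp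

theorem isConj_ofEntries_iff {a b c a' b' c' : ℤ} :
    IsConj (ofEntries a b c) (ofEntries a' b' c') ↔
      a = a' ∧ b = b' ∧ (Int.gcd a b : ℤ) ∣ c' - c := by
  rw [isConj_iff]
  constructor
  · rintro ⟨g, hg⟩
    obtain ⟨p, q, r, rfl⟩ := exists_eq_ofEntries g
    rw [mul_inv_eq_iff_eq_mul, ofEntries_mul, ofEntries_mul, ofEntries_inj] at hg
    obtain ⟨h1, h2, h3⟩ := hg
    obtain rfl : a = a' := by linarith
    obtain rfl : b = b' := by linarith
    refine ⟨rfl, rfl, ?_⟩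
    have : c' - c = b * p - a * q := by linarith
    rw [this]
    exact dvd_sub ((Int.gcd_dvd_right a b).mul_right p) ((Int.gcd_dvd_left a b).mul_right q)
  · rintro ⟨rfl, rfl, t, ht⟩
    refine ⟨ofEntries (Int.gcdB a b * t) (-(Int.gcdA a b * t)) 0, ?_⟩
    rw [mul_inv_eq_iff_eq_mul, ofEntries_mul, ofEntries_mul, ofEntries_inj]
    rw [Int.gcd_eq_gcd_ab] at ht
    exact ⟨by ring, by ring, by linear_combination -ht⟩

theorem exists_of_mem_wordBall {n : ℕ} {g : Heis} (hg : g ∈ wordBall {x, y} n) :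
    ∃ a b c : ℤ, g = ofEntries a b c ∧ |a| ≤ n ∧ |b| ≤ n ∧ |c| ≤ (n : ℤ) ^ 2 := by
  obtain ⟨L, hL, hS, rfl⟩ := hg
  induction L generalizing n with
  | nil => exact ⟨0, 0, 0, by simp [one_eq_ofEntries], by simp, by simp, by simp⟩
  | cons s L ih =>
    simp only [List.length_cons] at hL
    obtain ⟨k, rfl⟩ : ∃ k, n = k + 1 := ⟨n - 1, by omega⟩
    obtain ⟨a, b, c, hg, ha, hb, hc⟩ :=
      ih (n := k) (by omega) (fun t ht => hS t (List.mem_cons_of_mem _ ht))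
    have hs := hS s List.mem_cons_self
    rw [List.prod_cons, hg]
    simp only [Set.mem_union, Set.mem_inv, Set.mem_insert_iff, Set.mem_singleton_iff,
      inv_eq_iff_eq_inv] at hs
    rw [abs_le] at ha hb hc
    push_cast
    rcases hs with (rfl | rfl) | (rfl | rfl)
    · refine ⟨_, _, _, by rw [x_eq_ofEntries, ofEntries_mul], ?_, ?_, ?_⟩ <;> rw [abs_le] <;>
        constructor <;> nlinarith
    · refine ⟨_, _, _, by rw [y_eq_ofEntries, ofEntries_mul], ?_, ?_, ?_⟩ <;> rw [abs_le] <;>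
        constructor <;> nlinarith
    · refine ⟨_, _, _, by rw [inv_x_eq_ofEntries, ofEntries_mul], ?_, ?_, ?_⟩ <;> rw [abs_le] <;>
        constructor <;> nlinarith
    · refine ⟨_, _, _, by rw [inv_y_eq_ofEntries, ofEntries_mul], ?_, ?_, ?_⟩ <;> rw [abs_le] <;>
        constructor <;> nlinarith

theorem ofEntries_mem_wordBall {a b k n : ℕ} (hb : 1 ≤ b) (hk : k ≤ a) (hn : a + b ≤ n) :
    ofEntries a b (k + a * (b - 1)) ∈ wordBall {x, y} n := by
  obtain ⟨b, rfl⟩ : ∃ b', b = b' + 1 := ⟨b - 1, by omega⟩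
  obtain ⟨a, rfl⟩ := Nat.exists_eq_add_of_le hk
  refine ⟨List.replicate k x ++ [y] ++ List.replicate a x ++ List.replicate b y, ?_, ?_, ?_⟩
  · simp
    omega
  · intro t ht
    simp only [List.mem_append, List.mem_replicate, List.mem_singleton] at ht
    left
    rcases ht with ((ht | ht) | ht) | ht <;> simp [ht]
  · simp only [List.prod_append, List.prod_replicate, List.prod_singleton, x_pow, y_pow]
    rw [y_eq_ofEntries, ofEntries_mul, ofEntries_mul, ofEntries_mul, ofEntries_inj]
    push_cast
    exact ⟨by ring, by ring, by ring⟩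

/-- Conjugacy classes meeting the ball of radius `n`, as a set. -/
def ballClasses (n : ℕ) : Set (ConjClasses Heis) :=
  {c | ∃ g ∈ wordBall {x, y} n, ConjClasses.mk g = c}

theorem conjGrowth_eq_ncard (n : ℕ) :
    conjGrowth ({x, y} : Set Heis) n = (ballClasses n).ncard := rfl

/-- Nonzero integer vectors `(a, b)` in the box of radius `n` with a residue modulo `gcd a b`. -/
noncomputable def boxResidues (n : ℕ) : Finset (Σ _ : ℤ × ℤ, ℕ) :=
  ((Finset.Icc (-n : ℤ) n ×ˢ Finset.Icc (-n : ℤ) n).filter (fun p => p ≠ 0)).sigma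
    (fun p => Finset.range (Int.gcd p.1 p.2))

theorem ballClasses_subset (n : ℕ) :
    ballClasses n ⊆
      (fun c : ℤ => ConjClasses.mk (ofEntries 0 0 c)) '' (Finset.Icc (-(n : ℤ) ^ 2) ((n : ℤ) ^ 2)) ∪
      (fun q : Σ _ : ℤ × ℤ, ℕ => ConjClasses.mk (ofEntries q.1.1 q.1.2 q.2)) ''
        (boxResidues n) := by
  rintro _ ⟨g, hg, rfl⟩
  obtain ⟨a, b, c, rfl, ha, hb, hc⟩ := exists_of_mem_wordBall hg
  rw [abs_le] at ha hb hc
  by_cases h0 : (a, b) = (0 : ℤ × ℤ)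
  · obtain ⟨rfl, rfl⟩ := Prod.mk.inj h0
    exact Or.inl ⟨c, by simpa using hc, rfl⟩
  · right
    have hpos : 0 < Int.gcd a b := by
      rw [Int.gcd_pos_iff]
      by_contra! h
      exact h0 (Prod.ext h.1 h.2)
    have hpos' : (0 : ℤ) < Int.gcd a b := by exact_mod_cast hpos
    have hnn := Int.emod_nonneg c hpos'.ne'
    have hlt := Int.emod_lt_of_pos c hpos'
    refine ⟨⟨(a, b), (c % Int.gcd a b).toNat⟩, ?_, ?_⟩
    · simp only [boxResidues, Finset.coe_sigma, Set.mem_sigma_iff, Finset.mem_coe,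
        Finset.mem_filter, Finset.mem_product, Finset.mem_Icc, Finset.mem_range]
      exact ⟨⟨⟨ha, hb⟩, h0⟩, by omega⟩
    · simp only [ConjClasses.mk_eq_mk_iff_isConj, isConj_ofEntries_iff, Int.toNat_of_nonneg hnn]
      exact ⟨trivial, trivial, Int.dvd_self_sub_emod⟩

theorem finite_ballClasses (n : ℕ) : (ballClasses n).Finite :=
  (((Finset.finite_toSet _).image _).union ((Finset.finite_toSet _).image _)).subset
    (ballClasses_subset n)

theorem ncard_ballClasses_le (n : ℕ) :
    (ballClasses n).ncard ≤ 2 * n ^ 2 + 1 + (boxResidues n).card := by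
  refine (Set.ncard_le_ncard (ballClasses_subset n)
    (((Finset.finite_toSet _).image _).union ((Finset.finite_toSet _).image _))).trans ?_
  refine (Set.ncard_union_le _ _).trans (add_le_add ?_ ?_)
  · refine (Set.ncard_image_le (Finset.finite_toSet _)).trans ?_
    rw [Set.ncard_coe_finset, Int.card_Icc]
    have : ((n ^ 2 : ℕ) : ℤ) = (n : ℤ) ^ 2 := by push_cast; rfl
    omega
  · refine (Set.ncard_image_le (Finset.finite_toSet _)).trans ?_
    rw [Set.ncard_coe_finset]

theorem sum_gcd_le_ncard_ballClasses {m n : ℕ} (h : 2 * m ≤ n) :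
    ∑ p ∈ Finset.Ioc 0 m ×ˢ Finset.Ioc 0 m, Nat.gcd p.1 p.2 ≤ (ballClasses n).ncard := by
  let T : Finset (Σ _ : ℕ × ℕ, ℕ) :=
    (Finset.Ioc 0 m ×ˢ Finset.Ioc 0 m).sigma (fun p => Finset.range (Nat.gcd p.1 p.2))
  have hT : T.card = ∑ p ∈ Finset.Ioc 0 m ×ˢ Finset.Ioc 0 m, Nat.gcd p.1 p.2 := by
    simp [T, Finset.card_sigma]
  let f : (Σ _ : ℕ × ℕ, ℕ) → ConjClasses Heis := fun q =>
    ConjClasses.mk (ofEntries q.1.1 q.1.2 (q.2 + q.1.1 * (q.1.2 - 1)))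
  have hf : Set.InjOn f T := by
    rintro ⟨⟨a, b⟩, k⟩ hk ⟨⟨a', b'⟩, k'⟩ hk' heq
    simp only [T, Finset.coe_sigma, Set.mem_sigma_iff, Finset.mem_coe, Finset.mem_range] at hk hk'
    simp only [f, ConjClasses.mk_eq_mk_iff_isConj, isConj_ofEntries_iff, Nat.cast_inj,
      Int.gcd_natCast_natCast] at heq
    obtain ⟨rfl, rfl, hd⟩ := heq
    have hd' : ((Nat.gcd a b : ℕ) : ℤ) ∣ (k' : ℤ) - k := by simpa using hd
    have := Nat.ModEq.eq_of_lt_of_lt (Nat.modEq_iff_dvd.mpr hd') hk.2 hk'.2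
    rw [this]
  rw [← hT, ← Set.ncard_coe_finset, ← hf.ncard_image]
  refine Set.ncard_le_ncard ?_ (finite_ballClasses n)
  rintro _ ⟨⟨⟨a, b⟩, k⟩, hk, rfl⟩
  simp only [T, Finset.coe_sigma, Set.mem_sigma_iff, Finset.mem_coe, Finset.mem_range,
    Finset.mem_product, Finset.mem_Ioc] at hk
  obtain ⟨⟨ha, hb⟩, hk⟩ := hk
  have := Nat.gcd_le_left b ha.1
  exact ⟨_, ofEntries_mem_wordBall (a := a) (b := b) (k := k)
    (by omega) (by omega) (by omega), rfl⟩

end Heis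

theorem card_filter_dvd_product (m d : ℕ) :
    ((Finset.Ioc 0 m ×ˢ Finset.Ioc 0 m).filter (fun p => d ∣ p.1 ∧ d ∣ p.2)).card
      = (m / d) ^ 2 := by
  rw [Finset.filter_product, Finset.card_product, Nat.Ioc_filter_dvd_card_eq_div, sq]

theorem sum_Ioc_one_inv_sq_le (k : ℕ) :
    ∑ e ∈ Finset.Ioc 1 k, ((e : ℝ) ^ 2)⁻¹ ≤ 3 / 4 := by
  rcases Nat.lt_or_ge k 2 with hk | hk
  · rw [Finset.Ioc_eq_empty_of_le (by omega)]
    norm_num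
  · have h := sum_Ioc_inv_sq_le_sub (α := ℝ) two_ne_zero hk
    have hk0 : (0 : ℝ) ≤ (k : ℝ)⁻¹ := by positivity
    rw [← Finset.sum_Ioc_consecutive _ one_le_two hk,
      show Finset.Ioc 1 2 = {2} from rfl, Finset.sum_singleton]
    norm_num at h ⊢
    linarith

theorem div_sq_le_card_gcd_eq (m : ℕ) {d : ℕ} (hd : 0 < d) :
    ((m / d : ℕ) : ℝ) ^ 2 / 4 ≤
      (((Finset.Ioc 0 m ×ˢ Finset.Ioc 0 m).filter (fun p => Nat.gcd p.1 p.2 = d)).card : ℝ) := by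
  set k := m / d with hk
  have hsub : (Finset.Ioc 0 m ×ˢ Finset.Ioc 0 m).filter (fun p => d ∣ p.1 ∧ d ∣ p.2) ⊆
      (Finset.Ioc 0 m ×ˢ Finset.Ioc 0 m).filter (fun p => Nat.gcd p.1 p.2 = d) ∪
      (Finset.Ioc 1 k).biUnion (fun e => (Finset.Ioc 0 m ×ˢ Finset.Ioc 0 m).filter
        (fun p => d * e ∣ p.1 ∧ d * e ∣ p.2)) := by
    rintro ⟨a, b⟩ hp
    simp only [Finset.mem_filter, Finset.mem_union, Finset.mem_biUnion, Finset.mem_product,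
      Finset.mem_Ioc] at hp ⊢
    obtain ⟨⟨ha, hb⟩, hda, hdb⟩ := hp
    obtain ⟨e, he⟩ := Nat.dvd_gcd hda hdb
    have hpos : 0 < Nat.gcd a b := Nat.gcd_pos_of_pos_left _ ha.1
    have hle := Nat.gcd_le_left b ha.1
    rcases Nat.lt_or_ge 1 e with h1 | h1
    · refine Or.inr ⟨e, ⟨h1, ?_⟩, ⟨ha, hb⟩, he ▸ Nat.gcd_dvd_left a b, he ▸ Nat.gcd_dvd_right a b⟩
      rw [hk, Nat.le_div_iff_mul_le hd, mul_comm, ← he]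
      omega
    · have : e ≠ 0 := by rintro rfl; simp at he; omega
      obtain rfl : e = 1 := by omega
      exact Or.inl ⟨⟨ha, hb⟩, by simpa using he⟩
  have h1 := (Finset.card_le_card hsub).trans ((Finset.card_union_le _ _).trans
    (Nat.add_le_add_left Finset.card_biUnion_le _))
  simp only [card_filter_dvd_product, ← Nat.div_div_eq_div_mul, ← hk] at h1
  have h2 : (∑ e ∈ Finset.Ioc 1 k, ((k / e : ℕ) : ℝ) ^ 2) ≤ (k : ℝ) ^ 2 * (3 / 4) := by
    refine le_trans ?_ (mul_le_mul_of_nonneg_left (sum_Ioc_one_inv_sq_le k) (sq_nonneg _))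
    rw [Finset.mul_sum]
    refine Finset.sum_le_sum fun e _ => ?_
    rw [← div_eq_mul_inv, ← div_pow]
    exact pow_le_pow_left₀ (Nat.cast_nonneg _) Nat.cast_div_le 2
  have h3 : ((k : ℕ) : ℝ) ^ 2 ≤
      (((Finset.Ioc 0 m ×ˢ Finset.Ioc 0 m).filter (fun p => Nat.gcd p.1 p.2 = d)).card : ℝ) +
        ∑ e ∈ Finset.Ioc 1 k, ((k / e : ℕ) : ℝ) ^ 2 := by exact_mod_cast h1
  linarith

theorem harmonic_eq_sum_Ioc (m : ℕ) :
    ((harmonic m : ℚ) : ℝ) = ∑ d ∈ Finset.Ioc 0 m, (d : ℝ)⁻¹ := by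
  rw [harmonic_eq_sum_Icc]
  push_cast
  rfl

theorem mul_log_le_sum_gcd (m : ℕ) :
    (m : ℝ) ^ 2 / 16 * Real.log (m + 1) ≤
      ((∑ p ∈ Finset.Ioc 0 m ×ˢ Finset.Ioc 0 m, Nat.gcd p.1 p.2 : ℕ) : ℝ) := by
  have hmaps : ∀ p ∈ Finset.Ioc 0 m ×ˢ Finset.Ioc 0 m, Nat.gcd p.1 p.2 ∈ Finset.Ioc 0 m := by
    intro p hp
    simp only [Finset.mem_product, Finset.mem_Ioc] at hp ⊢
    exact ⟨Nat.gcd_pos_of_pos_left _ hp.1.1, (Nat.gcd_le_left _ hp.1.1).trans hp.1.2⟩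
  rw [← Finset.sum_fiberwise_of_maps_to hmaps]
  push_cast
  have hlog := log_add_one_le_harmonic m
  rw [harmonic_eq_sum_Ioc] at hlog
  push_cast at hlog
  refine (mul_le_mul_of_nonneg_left hlog (by positivity)).trans ?_
  rw [Finset.mul_sum]
  refine Finset.sum_le_sum fun d hd => ?_
  rw [Finset.mem_Ioc] at hd
  have hsum : ∑ p ∈ Finset.Ioc 0 m ×ˢ Finset.Ioc 0 m with Nat.gcd p.1 p.2 = d,
      (Nat.gcd p.1 p.2 : ℝ) =
      (((Finset.Ioc 0 m ×ˢ Finset.Ioc 0 m).filter (fun p => Nat.gcd p.1 p.2 = d)).card : ℝ) * d := by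
    rw [Finset.sum_congr rfl (g := fun _ => (d : ℝ))
      (fun p hp => by rw [(Finset.mem_filter.mp hp).2])]
    simp
  rw [hsum]
  have hd0 : (0 : ℝ) < d := by exact_mod_cast hd.1
  have hquot : (m : ℝ) / (2 * d) ≤ ((m / d : ℕ) : ℝ) := by
    rw [div_le_iff₀ (by positivity)]
    have h1 : 1 ≤ m / d := (Nat.one_le_div_iff hd.1).mpr hd.2
    have h2 := Nat.div_add_mod m d
    have h3 := Nat.mod_lt m hd.1
    have : m ≤ m / d * (2 * d) := by nlinarith
    exact_mod_cast this
  calc (m : ℝ) ^ 2 / 16 * (d : ℝ)⁻¹ = ((m : ℝ) / (2 * d)) ^ 2 / 4 * d := by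
        field_simp
        ring
    _ ≤ ((m / d : ℕ) : ℝ) ^ 2 / 4 * d := by gcongr
    _ ≤ _ := by gcongr; exact div_sq_le_card_gcd_eq m hd.1

theorem card_filter_dvd_Icc_neg_le (n : ℕ) {d : ℕ} (hd : 0 < d) :
    ((Finset.Icc (-n : ℤ) n).filter (fun a => (d : ℤ) ∣ a)).card ≤ 2 * (n / d) + 1 := by
  have hsub : (Finset.Icc (-n : ℤ) n).filter (fun a => (d : ℤ) ∣ a) ⊆
      (Finset.Icc (-(n / d : ℕ) : ℤ) (n / d : ℕ)).image (fun t => (d : ℤ) * t) := by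
    intro a ha
    simp only [Finset.mem_filter, Finset.mem_Icc, Finset.mem_image] at ha ⊢
    obtain ⟨⟨h1, h2⟩, t, rfl⟩ := ha
    have hd' : (0 : ℤ) < d := by exact_mod_cast hd
    push_cast
    refine ⟨t, ⟨?_, ?_⟩, rfl⟩
    · rw [neg_le, Int.le_ediv_iff_mul_le hd']
      linarith
    · rw [Int.le_ediv_iff_mul_le hd']
      linarith
  refine (Finset.card_le_card hsub).trans (Finset.card_image_le.trans ?_)
  rw [Int.card_Icc]
  omega

theorem card_boxResidues_le (n : ℕ) :
    ((Heis.boxResidues n).card : ℝ) ≤ 9 * (n : ℝ) ^ 2 * (1 + Real.log n) := by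
  set B := (Finset.Icc (-n : ℤ) n ×ˢ Finset.Icc (-n : ℤ) n).filter (fun p => p ≠ 0) with hB
  have hcard : (Heis.boxResidues n).card = ∑ p ∈ B, Int.gcd p.1 p.2 := by
    simp [Heis.boxResidues, Finset.card_sigma, hB]
  have hmaps : ∀ p ∈ B, Int.gcd p.1 p.2 ∈ Finset.Ioc 0 n := by
    rintro ⟨a, b⟩ hp
    simp only [hB, Finset.mem_filter, Finset.mem_product, Finset.mem_Icc, Finset.mem_Ioc] at hp ⊢
    obtain ⟨⟨ha, hb⟩, h0⟩ := hp
    by_cases ha0 : a = 0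
    · have hb0 : b ≠ 0 := fun h => h0 (Prod.ext ha0 h)
      subst ha0
      rw [Int.gcd_zero_left]
      omega
    · refine ⟨Int.gcd_pos_of_ne_zero_left _ ha0, ?_⟩
      have := Nat.gcd_le_left b.natAbs (Int.natAbs_pos.mpr ha0)
      rw [Int.gcd_def]
      omega
  rw [hcard, ← Finset.sum_fiberwise_of_maps_to hmaps]
  push_cast
  have hlog := harmonic_le_one_add_log n
  rw [harmonic_eq_sum_Ioc] at hlog
  refine le_trans ?_ (mul_le_mul_of_nonneg_left hlog (by positivity))
  rw [Finset.mul_sum]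
  refine Finset.sum_le_sum fun d hd => ?_
  rw [Finset.mem_Ioc] at hd
  have hsum : ∑ p ∈ B with Int.gcd p.1 p.2 = d, (Int.gcd p.1 p.2 : ℝ) =
      ((B.filter (fun p => Int.gcd p.1 p.2 = d)).card : ℝ) * d := by
    rw [Finset.sum_congr rfl (g := fun _ => (d : ℝ))
      (fun p hp => by rw [(Finset.mem_filter.mp hp).2])]
    simp
  rw [hsum]
  have hsub : B.filter (fun p => Int.gcd p.1 p.2 = d) ⊆
      (Finset.Icc (-n : ℤ) n).filter (fun a => (d : ℤ) ∣ a) ×ˢ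
        (Finset.Icc (-n : ℤ) n).filter (fun a => (d : ℤ) ∣ a) := by
    rintro ⟨a, b⟩ hp
    simp only [hB, Finset.mem_filter, Finset.mem_product] at hp ⊢
    obtain ⟨⟨⟨ha, hb⟩, -⟩, hg⟩ := hp
    exact ⟨⟨ha, hg ▸ Int.gcd_dvd_left a b⟩, ⟨hb, hg ▸ Int.gcd_dvd_right a b⟩⟩
  have hle := Finset.card_le_card hsub
  rw [Finset.card_product] at hle
  have h1 : 1 ≤ n / d := (Nat.one_le_div_iff hd.1).mpr hd.2
  have hline : ((Finset.Icc (-n : ℤ) n).filter (fun a => (d : ℤ) ∣ a)).card ≤ 3 * (n / d) :=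
    (card_filter_dvd_Icc_neg_le n hd.1).trans (by omega)
  have hle' := hle.trans (Nat.mul_le_mul hline hline)
  have hle'' : ((B.filter (fun p => Int.gcd p.1 p.2 = d)).card : ℝ) ≤
      3 * ((n / d : ℕ) : ℝ) * (3 * ((n / d : ℕ) : ℝ)) := by exact_mod_cast hle'
  have hd0 : (0 : ℝ) < d := by exact_mod_cast hd.1
  have hq : ((n / d : ℕ) : ℝ) ≤ n / d := Nat.cast_div_le
  calc _ ≤ 3 * ((n / d : ℕ) : ℝ) * (3 * ((n / d : ℕ) : ℝ)) * d := by gcongr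
    _ ≤ 3 * ((n : ℝ) / d) * (3 * ((n : ℝ) / d)) * d := by gcongr
    _ = 9 * (n : ℝ) ^ 2 * (d : ℝ)⁻¹ := by
        field_simp
        ring

/-- The conjugacy growth function of the discrete Heisenberg group with respect
to `S = {x, y}` is `Θ(n² log n)`. -/
theorem heisenberg_conj_growth :
    ∃ C : ℝ, 1 ≤ C ∧ ∃ N : ℕ, ∀ n ≥ N,
      (1 / C) * (n : ℝ) ^ 2 * Real.log n ≤ (conjGrowth ({Heis.x, Heis.y} : Set Heis) n : ℝ) ∧
      (conjGrowth ({Heis.x, Heis.y} : Set Heis) n : ℝ) ≤ C * (n : ℝ) ^ 2 * Real.log n := by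
  refine ⟨288, by norm_num, 4, fun n hn => ?_⟩
  rw [Heis.conjGrowth_eq_ncard]
  have hn4 : (4 : ℝ) ≤ n := by exact_mod_cast hn
  have hlog1 : 1 ≤ Real.log n := by
    rw [Real.le_log_iff_exp_le (by linarith)]
    linarith [Real.exp_one_lt_d9]
  constructor
  · have h := Heis.sum_gcd_le_ncard_ballClasses (m := n / 2) (n := n) (by omega)
    refine le_trans ?_ ((mul_log_le_sum_gcd (n / 2)).trans (Nat.cast_le.mpr h))
    have hm : (n : ℝ) / 3 ≤ ((n / 2 : ℕ) : ℝ) := by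
      have : n ≤ 3 * (n / 2) := by omega
      have : (n : ℝ) ≤ 3 * ((n / 2 : ℕ) : ℝ) := by exact_mod_cast this
      linarith
    have hm' : (n : ℝ) ≤ (((n / 2 : ℕ) : ℝ) + 1) ^ 2 := by
      have : n ≤ 2 * (n / 2) + 1 := by omega
      have : (n : ℝ) ≤ 2 * ((n / 2 : ℕ) : ℝ) + 1 := by exact_mod_cast this
      nlinarith
    have hl : Real.log n / 2 ≤ Real.log (((n / 2 : ℕ) : ℝ) + 1) := by
      have := Real.log_le_log (by linarith) hm'
      rw [Real.log_pow] at this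
      push_cast at this
      linarith
    calc 1 / 288 * (n : ℝ) ^ 2 * Real.log n = ((n : ℝ) / 3) ^ 2 / 16 * (Real.log n / 2) := by ring
      _ ≤ _ := by gcongr
  · have h : ((Heis.ballClasses n).ncard : ℝ) ≤
        2 * (n : ℝ) ^ 2 + 1 + ((Heis.boxResidues n).card : ℝ) := by
      exact_mod_cast Heis.ncard_ballClasses_le n
    have hb := card_boxResidues_le n
    have hsq : (1 : ℝ) ≤ (n : ℝ) ^ 2 := by nlinarith
    have hprod : (n : ℝ) ^ 2 ≤ (n : ℝ) ^ 2 * Real.log n :=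
      le_mul_of_one_le_right (by positivity) hlog1
    nlinarith
end
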